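/- (Stability under uniform strain; accuracy of critical strain.) Let F ≥ r*/2. Then for every N-periodic blending function η : ℤ → [0,1], c_η(y^F) ≥ φ''(F) + 4φ''(2F); and for every N-periodic blending function γ : ℤ → [0,1] with α_ξ := (γ_ξ + γ_{ξ−1})/2, c_γ(y^F) ≥ φ''(F) + 4φ''(2F) − 2 C₂(2F) max_ξ |Δ²α_ξ|. -/

import Mathlib

open scoped BigOperators ENNReal
open Finset

noncomputable section

/-- The lattice spacing `ε = 1/N`. -/
def eps (N : ℕ) : ℝ := (N : ℝ)⁻¹

/-- `u : ℤ → ℝ` is `N`-periodic. -/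
def IsPeriodic (N : ℕ) (u : ℤ → ℝ) : Prop := ∀ ξ : ℤ, u (ξ + N) = u ξ

/-- Membership in the space `𝒰` of `N`-periodic mean-zero displacements. -/
def inU (N : ℕ) (u : ℤ → ℝ) : Prop :=
  IsPeriodic N u ∧ ∑ ξ ∈ Finset.Icc (1 : ℤ) (N : ℤ), u ξ = 0

/-- The uniform deformation `y^F_ξ = F ε ξ`. -/
def yUnif (N : ℕ) (F : ℝ) : ℤ → ℝ := fun ξ => F * eps N * ξ

/-- Membership in the space `𝒴` of admissible deformations. -/
def inY (N : ℕ) (y : ℤ → ℝ) : Prop :=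
  ∃ F : ℝ, 0 < F ∧ ∃ u : ℤ → ℝ, inU N u ∧ y = fun ξ => yUnif N F ξ + u ξ

/-- The discrete first derivative `y'_ξ = (y_ξ - y_{ξ-1})/ε`. -/
def d1 (N : ℕ) (y : ℤ → ℝ) (ξ : ℤ) : ℝ := (y ξ - y (ξ - 1)) / eps N

/-- The discrete second derivative `y''_ξ`. -/
def d2 (N : ℕ) (y : ℤ → ℝ) (ξ : ℤ) : ℝ :=
  (y (ξ + 1) - 2 * y ξ + y (ξ - 1)) / (eps N) ^ 2

/-- The discrete third derivative `y'''_ξ`. -/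
def d3 (N : ℕ) (y : ℤ → ℝ) (ξ : ℤ) : ℝ :=
  (y (ξ + 1) - 3 * y ξ + 3 * y (ξ - 1) - y (ξ - 2)) / (eps N) ^ 3

/-- The BQC energy `Φ_{α,β}`. -/
def PhiBQC (N : ℕ) (φ : ℝ → ℝ) (α β : ℤ → ℝ) (y : ℤ → ℝ) : ℝ :=
  eps N * ∑ ξ ∈ Finset.Icc (1 : ℤ) (N : ℤ),
    (φ (d1 N y ξ) + α ξ * φ (2 * d1 N y ξ) + β ξ * φ (d1 N y ξ + d1 N y (ξ + 1)))

/-- The BQNL energy with blending function `η`. -/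
def PhiBQNL (N : ℕ) (φ : ℝ → ℝ) (η : ℤ → ℝ) : (ℤ → ℝ) → ℝ :=
  PhiBQC N φ (fun ξ => 1 - (η ξ + η (ξ - 1)) / 2) η

/-- The BQCE energy with blending function `γ`. -/
def PhiBQCE (N : ℕ) (φ : ℝ → ℝ) (γ : ℤ → ℝ) : (ℤ → ℝ) → ℝ :=
  PhiBQC N φ (fun ξ => (γ ξ + γ (ξ - 1)) / 2) (fun ξ => 1 - (γ (ξ + 1) + γ (ξ - 1)) / 2)

/-- The atomistic energy `Φ`. -/
def PhiAt (N : ℕ) (φ : ℝ → ℝ) (y : ℤ → ℝ) : ℝ :=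
  eps N * ∑ ξ ∈ Finset.Icc (1 : ℤ) (N : ℤ),
    (φ (d1 N y ξ) + φ (d1 N y ξ + d1 N y (ξ + 1)))

/-- The first variation `δΨ(y)[u] = (d/dt)|_{t=0} Ψ(y+tu)`. -/
def fvar (Ψ : (ℤ → ℝ) → ℝ) (y u : ℤ → ℝ) : ℝ :=
  deriv (fun t : ℝ => Ψ (fun ξ => y ξ + t * u ξ)) 0

/-- The second variation `δ²Ψ(y)[u,u] = (d²/dt²)|_{t=0} Ψ(y+tu)`. -/
def svar (Ψ : (ℤ → ℝ) → ℝ) (y u : ℤ → ℝ) : ℝ :=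
  iteratedDeriv 2 (fun t : ℝ => Ψ (fun ξ => y ξ + t * u ξ)) 0

/-- `max_ξ |v_ξ|` (for a periodic sequence this is a genuine maximum). -/
def supAbs (v : ℤ → ℝ) : ℝ := sSup (Set.range fun ξ => |v ξ|)

/-- `min_ξ y'_ξ` (for an admissible deformation this is a genuine minimum). -/
def infD1 (N : ℕ) (y : ℤ → ℝ) : ℝ := sInf (Set.range fun ξ => d1 N y ξ)

/-- The constant `C_i(r₀) = sup_{r ≥ r₀} |φ^(i)(r)|`. -/
def Cbound (φ : ℝ → ℝ) (i : ℕ) (r₀ : ℝ) : ℝ :=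
  sSup ((fun r => |iteratedDeriv i φ r|) '' Set.Ici r₀)

/-- The `ℓ^p_ε` norm over one period, `p ∈ [1,∞]`. -/
def lpnorm (N : ℕ) (p : ℝ≥0∞) (v : ℤ → ℝ) : ℝ :=
  if p = ⊤ then supAbs v
  else (eps N * ∑ ξ ∈ Finset.Icc (1 : ℤ) (N : ℤ), |v ξ| ^ p.toReal) ^ (1 / p.toReal)

/-- The Hessian coefficient `A_ξ` of the atomistic energy. -/
def Acoef (N : ℕ) (φ : ℝ → ℝ) (y : ℤ → ℝ) (ξ : ℤ) : ℝ :=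
  iteratedDeriv 2 φ (d1 N y ξ) + 2 * iteratedDeriv 2 φ (d1 N y ξ + d1 N y (ξ + 1))
    + 2 * iteratedDeriv 2 φ (d1 N y (ξ - 1) + d1 N y ξ)

/-- The Hessian coefficient `Ā_ξ` of the BQC energy. -/
def AbarCoef (N : ℕ) (φ : ℝ → ℝ) (α β : ℤ → ℝ) (y : ℤ → ℝ) (ξ : ℤ) : ℝ :=
  iteratedDeriv 2 φ (d1 N y ξ) + 2 * β ξ * iteratedDeriv 2 φ (d1 N y ξ + d1 N y (ξ + 1))
    + 2 * β (ξ - 1) * iteratedDeriv 2 φ (d1 N y (ξ - 1) + d1 N y ξ)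
    + 4 * α ξ * iteratedDeriv 2 φ (2 * d1 N y ξ)

/-- The coercivity constant `inf { δ²Ψ(y)[u,u] : u ∈ 𝒰, ‖u'‖_{ℓ²_ε} = 1 }`. -/
def coercConst (N : ℕ) (Ψ : (ℤ → ℝ) → ℝ) (y : ℤ → ℝ) : ℝ :=
  sInf { c : ℝ | ∃ u : ℤ → ℝ, inU N u ∧ lpnorm N 2 (d1 N u) = 1 ∧ c = svar Ψ y u }

end

/-- The second derivative of `t ↦ φ (c + t a)` at `0`. -/
lemma iteratedDeriv_two_comp_affine {φ : ℝ → ℝ} {c : ℝ} (hφ : ContDiffAt ℝ 2 φ c) (a : ℝ) :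
    iteratedDeriv 2 (fun t : ℝ => φ (c + t * a)) 0 = a ^ 2 * iteratedDeriv 2 φ c := by
  have haff (t : ℝ) : HasDerivAt (fun t : ℝ => c + t * a) a t := by
    simpa using ((hasDerivAt_id t).mul_const a).const_add c
  have hlim : Filter.Tendsto (fun t : ℝ => c + t * a) (nhds 0) (nhds c) := by
    simpa using (haff 0).continuousAt.tendsto
  have hfirst : ∀ᶠ x in nhds c, DifferentiableAt ℝ φ x :=
    (hφ.eventually (by simp)).mono fun x hx => hx.differentiableAt (by simp)
  have hderiv : deriv (fun t : ℝ => φ (c + t * a)) =ᶠ[nhds 0]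
      fun t => deriv φ (c + t * a) * a :=
    (hlim.eventually hfirst).mono fun t ht =>
      (ht.hasDerivAt.comp (h := fun t : ℝ => c + t * a) t (haff t)).deriv
  have hsecond : DifferentiableAt ℝ (deriv φ) (c + 0 * a) := by
    have h : ContDiffAt ℝ 1 (deriv φ) c := hφ.derivWithin (by norm_num)
    simpa using h.differentiableAt (by simp)
  have hcomp : HasDerivAt (fun t : ℝ => deriv φ (c + t * a) * a)
      (deriv (deriv φ) (c + 0 * a) * a * a) 0 :=
    (hsecond.hasDerivAt.comp (h := fun t : ℝ => c + t * a) 0 (haff 0)).mul_const a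
  rw [iteratedDeriv_succ, iteratedDeriv_one, hderiv.deriv_eq, hcomp.deriv,
    iteratedDeriv_succ, iteratedDeriv_one]
  simp only [zero_mul, add_zero]
  ring

lemma contDiffAt_comp_affine {φ : ℝ → ℝ} {c : ℝ} (hφ : ContDiffAt ℝ 2 φ c) (a : ℝ) :
    ContDiffAt ℝ 2 (fun t : ℝ => φ (c + t * a)) 0 := by
  have haff : ContDiffAt ℝ 2 (fun t : ℝ => c + t * a) 0 := by fun_prop
  exact ContDiffAt.comp (g := φ) 0 (by simpa using hφ) haff

lemma eps_pos {N : ℕ} (hN : 0 < N) : 0 < eps N := by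
  unfold eps; positivity

lemma d1_yUnif_add {N : ℕ} (hN : 0 < N) (F t : ℝ) (u : ℤ → ℝ) (ξ : ℤ) :
    d1 N (fun ζ => yUnif N F ζ + t * u ζ) ξ = F + t * d1 N u ξ := by
  have := (eps_pos hN).ne'
  simp only [d1, yUnif]
  push_cast
  field_simp
  ring

/-- The Hessian of the BQC energy at a uniform deformation. -/
lemma svar_PhiBQC_yUnif {N : ℕ} (hN : 0 < N) {φ : ℝ → ℝ} {F : ℝ}
    (hF : ContDiffAt ℝ 2 φ F) (hF2 : ContDiffAt ℝ 2 φ (2 * F)) (α β u : ℤ → ℝ) :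
    svar (PhiBQC N φ α β) (yUnif N F) u =
      eps N * ∑ ξ ∈ Finset.Icc (1 : ℤ) (N : ℤ),
        (d1 N u ξ ^ 2 * iteratedDeriv 2 φ F
          + α ξ * ((2 * d1 N u ξ) ^ 2 * iteratedDeriv 2 φ (2 * F))
          + β ξ * ((d1 N u ξ + d1 N u (ξ + 1)) ^ 2 * iteratedDeriv 2 φ (2 * F))) := by
  have hfun : (fun t : ℝ => PhiBQC N φ α β (fun ζ => yUnif N F ζ + t * u ζ)) =
      fun t => eps N * ∑ ξ ∈ Finset.Icc (1 : ℤ) (N : ℤ),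
        (φ (F + t * d1 N u ξ) + α ξ * φ (2 * F + t * (2 * d1 N u ξ))
          + β ξ * φ (2 * F + t * (d1 N u ξ + d1 N u (ξ + 1)))) := by
    funext t
    simp only [PhiBQC, d1_yUnif_add hN]
    congr 1
    refine Finset.sum_congr rfl fun ξ _ => ?_
    rw [show 2 * (F + t * d1 N u ξ) = 2 * F + t * (2 * d1 N u ξ) by ring,
      show F + t * d1 N u ξ + (F + t * d1 N u (ξ + 1))
        = 2 * F + t * (d1 N u ξ + d1 N u (ξ + 1)) by ring]
  have h1 := contDiffAt_comp_affine hF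
  have h2 := contDiffAt_comp_affine hF2
  have hα (ξ : ℤ) (a : ℝ) : ContDiffAt ℝ 2 (fun t : ℝ => α ξ * φ (2 * F + t * a)) 0 :=
    contDiffAt_const.mul (h2 a)
  have hβ (ξ : ℤ) (a : ℝ) : ContDiffAt ℝ 2 (fun t : ℝ => β ξ * φ (2 * F + t * a)) 0 :=
    contDiffAt_const.mul (h2 a)
  rw [svar, hfun, iteratedDeriv_const_mul_field, iteratedDeriv_fun_sum]
  · congr 1
    refine Finset.sum_congr rfl fun ξ _ => ?_
    rw [iteratedDeriv_fun_add ((h1 _).add (hα _ _)) (hβ _ _),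
      iteratedDeriv_fun_add (h1 _) (hα _ _), iteratedDeriv_const_mul_field,
      iteratedDeriv_const_mul_field, iteratedDeriv_two_comp_affine hF,
      iteratedDeriv_two_comp_affine hF2, iteratedDeriv_two_comp_affine hF2]
  · exact fun ξ _ => ((h1 _).add (hα _ _)).add (hβ _ _)

lemma sum_Icc_sub_pred (f : ℤ → ℝ) (n : ℕ) :
    ∑ ξ ∈ Finset.Icc (1 : ℤ) (n : ℤ), (f ξ - f (ξ - 1)) = f n - f 0 := by
  induction n with
  | zero => simp
  | succ n ih =>
    have h : Finset.Icc (1 : ℤ) ((n + 1 : ℕ) : ℤ) =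
        insert ((n : ℤ) + 1) (Finset.Icc (1 : ℤ) (n : ℤ)) := by
      ext x
      simp only [Finset.mem_Icc, Finset.mem_insert]
      omega
    rw [h, Finset.sum_insert (by simp), ih]
    push_cast
    simp

lemma IsPeriodic.sum_Icc_pred {N : ℕ} {f : ℤ → ℝ} (hf : IsPeriodic N f) :
    ∑ ξ ∈ Finset.Icc (1 : ℤ) (N : ℤ), f (ξ - 1) = ∑ ξ ∈ Finset.Icc (1 : ℤ) (N : ℤ), f ξ := by
  have h := sum_Icc_sub_pred f N
  have h0 := hf 0
  rw [Finset.sum_sub_distrib] at h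
  rw [zero_add] at h0
  linarith

lemma IsPeriodic.d1 {N : ℕ} {u : ℤ → ℝ} (hu : IsPeriodic N u) : IsPeriodic N (d1 N u) := by
  intro ξ
  simp only [_root_.d1]
  rw [hu ξ, show ξ + (N : ℤ) - 1 = ξ - 1 + N by ring, hu (ξ - 1)]

lemma lpnorm_two (N : ℕ) (v : ℤ → ℝ) :
    lpnorm N 2 v = √(eps N * ∑ ξ ∈ Finset.Icc (1 : ℤ) (N : ℤ), v ξ ^ 2) := by
  simp [lpnorm, Real.sqrt_eq_rpow]

/-- The normalized displacements over which the coercivity constant is taken exist. -/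
lemma exists_inU_lpnorm_d1_eq_one {N : ℕ} (hN : 2 ≤ N) :
    ∃ u : ℤ → ℝ, inU N u ∧ lpnorm N 2 (d1 N u) = 1 := by
  have hN0 : 0 < N := by omega
  have hNR : (N : ℝ) ≠ 0 := by positivity
  have he := eps_pos hN0
  let w : ℤ → ℝ := fun ξ => if (N : ℤ) ∣ ξ then 1 else 0
  let m : ℝ := (∑ ξ ∈ Finset.Icc (1 : ℤ) (N : ℤ), w ξ) / N
  let S : ℝ := eps N * ∑ ξ ∈ Finset.Icc (1 : ℤ) (N : ℤ), d1 N w ξ ^ 2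
  have hpred : ¬ (N : ℤ) ∣ (N : ℤ) - 1 := by
    intro h
    have := Int.le_of_dvd (by omega) h
    omega
  have hS : 0 < S := by
    refine mul_pos he (Finset.sum_pos' (fun _ _ => sq_nonneg _) ⟨N, ?_, ?_⟩)
    · simp only [Finset.mem_Icc]; omega
    · simp only [d1, w, dvd_refl, if_true, hpred, if_false]
      positivity
  have hd (ξ : ℤ) : d1 N (fun ξ => (√S)⁻¹ * (w ξ - m)) ξ = (√S)⁻¹ * d1 N w ξ := by
    simp only [d1]; ring
  refine ⟨fun ξ => (√S)⁻¹ * (w ξ - m), ⟨fun ξ => ?_, ?_⟩, ?_⟩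
  · simp [w]
  · rw [← Finset.mul_sum, Finset.sum_sub_distrib]
    simp only [Finset.sum_const, Int.card_Icc, m]
    simp only [add_sub_cancel_right, Int.toNat_natCast, nsmul_eq_mul]
    field_simp
    simp
  · rw [lpnorm_two]
    simp only [hd, mul_pow, ← Finset.mul_sum]
    rw [mul_left_comm, inv_pow, Real.sq_sqrt hS.le]
    change √(S⁻¹ * S) = 1
    rw [inv_mul_cancel₀ hS.ne', Real.sqrt_one]

/-- If `φ''(2F) ≤ 0`, dropping the nonnegative strain-gradient contribution of the Hessian bounds
the coercivity constant below by any lower bound of the Hessian coefficients. -/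
lemma le_coercConst_PhiBQC {N : ℕ} (hN : 2 ≤ N) {φ : ℝ → ℝ} {F : ℝ}
    (hF : ContDiffAt ℝ 2 φ F) (hF2 : ContDiffAt ℝ 2 φ (2 * F))
    (hneg : iteratedDeriv 2 φ (2 * F) ≤ 0) {α β : ℤ → ℝ} (hβ : IsPeriodic N β)
    (hβ0 : ∀ ξ, 0 ≤ β ξ) {m : ℝ}
    (hm : ∀ ξ, m ≤ iteratedDeriv 2 φ F
      + (4 * α ξ + 2 * β ξ + 2 * β (ξ - 1)) * iteratedDeriv 2 φ (2 * F)) :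
    m ≤ coercConst N (PhiBQC N φ α β) (yUnif N F) := by
  have hN0 : 0 < N := by omega
  obtain ⟨u₀, hu₀, hn₀⟩ := exists_inU_lpnorm_d1_eq_one hN
  refine le_csInf ⟨_, u₀, hu₀, hn₀, rfl⟩ ?_
  rintro _ ⟨u, hu, hn, rfl⟩
  rw [lpnorm_two, Real.sqrt_eq_one] at hn
  rw [svar_PhiBQC_yUnif hN0 hF hF2]
  set p := iteratedDeriv 2 φ F
  set q := iteratedDeriv 2 φ (2 * F)
  have hper := hu.1.d1
  set v := d1 N u
  have hshift : ∑ ξ ∈ Finset.Icc (1 : ℤ) (N : ℤ), β (ξ - 1) * v ξ ^ 2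
      = ∑ ξ ∈ Finset.Icc (1 : ℤ) (N : ℤ), β ξ * v (ξ + 1) ^ 2 := by
    have h : IsPeriodic N (fun ξ => β ξ * v (ξ + 1) ^ 2) := fun ξ => by
      simp only [hβ ξ, show ξ + (N : ℤ) + 1 = ξ + 1 + N by ring, hper (ξ + 1)]
    simpa using h.sum_Icc_pred
  calc m = eps N * ∑ ξ ∈ Finset.Icc (1 : ℤ) (N : ℤ), m * v ξ ^ 2 := by
        rw [← Finset.mul_sum, mul_left_comm, hn, mul_one]
    _ ≤ eps N * ∑ ξ ∈ Finset.Icc (1 : ℤ) (N : ℤ),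
          (p + (4 * α ξ + 2 * β ξ + 2 * β (ξ - 1)) * q) * v ξ ^ 2 := by
        have := (eps_pos hN0).le
        gcongr with ξ
        exact hm ξ
    _ = eps N * (∑ ξ ∈ Finset.Icc (1 : ℤ) (N : ℤ), (p + (4 * α ξ + 2 * β ξ) * q) * v ξ ^ 2
          + 2 * q * ∑ ξ ∈ Finset.Icc (1 : ℤ) (N : ℤ), β (ξ - 1) * v ξ ^ 2) := by
        congr 1
        rw [Finset.mul_sum, ← Finset.sum_add_distrib]
        exact Finset.sum_congr rfl fun ξ _ => by ring
    _ = eps N * ∑ ξ ∈ Finset.Icc (1 : ℤ) (N : ℤ),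
          ((p + (4 * α ξ + 2 * β ξ) * q) * v ξ ^ 2 + 2 * q * (β ξ * v (ξ + 1) ^ 2)) := by
        rw [hshift, Finset.mul_sum, ← Finset.sum_add_distrib]
    _ ≤ _ := by
        refine mul_le_mul_of_nonneg_left (Finset.sum_le_sum fun ξ _ => ?_) (eps_pos hN0).le
        have h : β ξ * q * (v ξ - v (ξ + 1)) ^ 2 ≤ 0 :=
          mul_nonpos_of_nonpos_of_nonneg (mul_nonpos_of_nonneg_of_nonpos (hβ0 ξ) hneg)
            (sq_nonneg _)
        linarith

/-- The second derivative is nonpositive from the inflection point on. -/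
lemma iteratedDeriv_two_nonpos_of_le {φ : ℝ → ℝ} {r s : ℝ} (hφ : ContDiffAt ℝ 2 φ r)
    (hconcave : ∀ x, r < x → iteratedDeriv 2 φ x < 0) (hs : r ≤ s) :
    iteratedDeriv 2 φ s ≤ 0 := by
  rcases hs.lt_or_eq with h | rfl
  · exact (hconcave s h).le
  · have hc : ContinuousAt (iteratedDeriv 2 φ) r := by
      unfold iteratedDeriv
      exact (hφ.continuousAt_iteratedFDeriv (k := 2) le_rfl).eval_const _
    exact le_of_tendsto (hc.tendsto.mono_left (nhdsWithin_le_nhds (s := Set.Ioi r)))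
      (Filter.eventually_of_mem self_mem_nhdsWithin fun x hx => (hconcave x hx).le)

/-- Stability under uniform strain; accuracy of the critical strain. -/
theorem uniform_strain_stability
    (N : ℕ) (hN : 5 ≤ N) (φ : ℝ → ℝ) (hφ : ContDiffOn ℝ 4 φ (Set.Ioi 0))
    (hC : ∀ i ≤ 4, ∀ r₀ : ℝ, 0 < r₀ →
      BddAbove ((fun r => |iteratedDeriv i φ r|) '' Set.Ici r₀))
    (rstar : ℝ) (hrstar : 0 < rstar)
    (hconvex : ∀ r : ℝ, 0 < r → r < rstar → 0 < iteratedDeriv 2 φ r)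
    (hconcave : ∀ r : ℝ, rstar < r → iteratedDeriv 2 φ r < 0)
    (F : ℝ) (hF : rstar / 2 ≤ F) :
    (∀ η : ℤ → ℝ, IsPeriodic N η → (∀ ξ, η ξ ∈ Set.Icc (0 : ℝ) 1) →
        iteratedDeriv 2 φ F + 4 * iteratedDeriv 2 φ (2 * F)
          ≤ coercConst N (PhiBQNL N φ η) (yUnif N F)) ∧
      (∀ γ : ℤ → ℝ, IsPeriodic N γ → (∀ ξ, γ ξ ∈ Set.Icc (0 : ℝ) 1) →
        ∀ α : ℤ → ℝ, α = (fun ξ => (γ ξ + γ (ξ - 1)) / 2) →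
          iteratedDeriv 2 φ F + 4 * iteratedDeriv 2 φ (2 * F)
              - 2 * Cbound φ 2 (2 * F) * supAbs (fun ξ => α (ξ + 1) - 2 * α ξ + α (ξ - 1))
            ≤ coercConst N (PhiBQCE N φ γ) (yUnif N F)) := by
  have hFpos : 0 < F := by linarith
  have hsmooth (r : ℝ) (hr : 0 < r) : ContDiffAt ℝ 2 φ r :=
    (hφ.contDiffAt (Ioi_mem_nhds hr)).of_le (by norm_num)
  have hF1 := hsmooth F hFpos
  have hF2 := hsmooth (2 * F) (by linarith)
  have hneg := iteratedDeriv_two_nonpos_of_le (hsmooth rstar hrstar) hconcave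
    (show rstar ≤ 2 * F by linarith)
  refine ⟨fun η hη hη01 => ?_, ?_⟩
  · exact le_coercConst_PhiBQC (by omega) hF1 hF2 hneg hη (fun ξ => (hη01 ξ).1)
      fun ξ => le_of_eq (by ring)
  rintro γ hγ hγ01 α rfl
  refine le_coercConst_PhiBQC (by omega) hF1 hF2 hneg (fun ξ => ?_) (fun ξ => ?_) fun ξ => ?_
  · simp only [show ξ + (N : ℤ) + 1 = ξ + 1 + N by ring,
      show ξ + (N : ℤ) - 1 = ξ - 1 + N by ring, hγ (ξ + 1), hγ (ξ - 1)]
  · linarith [(hγ01 (ξ + 1)).2, (hγ01 (ξ - 1)).2]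
  let δ : ℤ → ℝ := fun ξ => (γ (ξ + 1) + γ (ξ + 1 - 1)) / 2 - 2 * ((γ ξ + γ (ξ - 1)) / 2)
    + (γ (ξ - 1) + γ (ξ - 1 - 1)) / 2
  have hbdd : BddAbove (Set.range fun ξ => |δ ξ|) := by
    refine ⟨2, ?_⟩
    rintro _ ⟨ζ, rfl⟩
    have h1 := hγ01 (ζ + 1)
    have h2 := hγ01 ζ
    have h3 := hγ01 (ζ - 1)
    have h4 := hγ01 (ζ - 1 - 1)
    simp only [Set.mem_Icc] at h1 h2 h3 h4
    simp only [δ, add_sub_cancel_right, abs_le]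
    constructor <;> linarith
  have hδ : |δ ξ| ≤ supAbs δ := le_csSup hbdd ⟨ξ, rfl⟩
  have hCF : |iteratedDeriv 2 φ (2 * F)| ≤ Cbound φ 2 (2 * F) :=
    le_csSup (hC 2 (by norm_num) (2 * F) (by linarith)) ⟨2 * F, Set.self_mem_Ici, rfl⟩
  have hprod : iteratedDeriv 2 φ (2 * F) * δ ξ ≤ Cbound φ 2 (2 * F) * supAbs δ :=
    calc iteratedDeriv 2 φ (2 * F) * δ ξ ≤ |iteratedDeriv 2 φ (2 * F)| * |δ ξ| := by
          rw [← abs_mul]; exact le_abs_self _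
      _ ≤ _ := mul_le_mul hCF hδ (abs_nonneg _) ((abs_nonneg _).trans hCF)
  have hcoef : 4 * ((γ ξ + γ (ξ - 1)) / 2) + 2 * (1 - (γ (ξ + 1) + γ (ξ - 1)) / 2)
      + 2 * (1 - (γ (ξ - 1 + 1) + γ (ξ - 1 - 1)) / 2) = 4 - 2 * δ ξ := by
    simp only [δ, add_sub_cancel_right, sub_add_cancel]
    ring
  change _ - 2 * Cbound φ 2 (2 * F) * supAbs δ ≤ _
  rw [hcoef]
  linarith
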